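/- arXiv:1701.01217 — 10 statements merged into one kernel-verified Lean document; each statement's English description precedes it below -/
import Mathlib

section
/- Let a < b be real numbers, let f : ℝ → ℝ be continuous on [a,b], and let k : ℝ × ℝ → ℝ be continuous on [a,b] × [a,b] with |k(t,s)| ≤ M for all t,s ∈ [a,b]. Then for every ε > 0 and every continuous function ψ : ℝ → ℝ satisfying |ψ(t) - f(t) - ∫_a^t k(t,s) ψ(s) ds| ≤ ε for all t ∈ [a,b], there exists a continuous function φ : ℝ → ℝ satisfying φ(t) = f(t) + ∫_a^t k(t,s) φ(s) ds for all t ∈ [a,b] and such that |φ(t) - ψ(t)| ≤ (1 + e^{M(b-a)}) ε for all t ∈ [a,b]. In other words, the Volterra integral equation x(t) = f(t) + ∫_a^t k(t,s) x(s) ds has Hyers–Ulam stability on [a,b] with stability constant 1 + e^{M(b-a)}. -/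
open Set in
/-- A Volterra equation on `[a, b]` whose kernel is bounded by `M` and whose inhomogeneity is
bounded by `ε` has a continuous solution bounded by `ε * exp (M * (b - a))`, namely the sum of the
iterates of the integral operator. -/
theorem exists_volterra_solution_abs_le {a b M ε : ℝ} (hab : a ≤ b) {K : ℝ → ℝ → ℝ}
    (hK : Continuous (Function.uncurry K)) (hKM : ∀ t s, |K t s| ≤ M)
    {r : ℝ → ℝ} (hr : Continuous r) (hrε : ∀ t, |r t| ≤ ε) :
    ∃ δ : ℝ → ℝ, Continuous δ ∧
      (∀ t ∈ Icc a b, δ t = r t + ∫ s in a..t, K t s * δ s) ∧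
      ∀ t, |δ t| ≤ ε * Real.exp (M * (b - a)) := by
  have hM : 0 ≤ M := (abs_nonneg _).trans (hKM 0 0)
  have hε : 0 ≤ ε := (abs_nonneg _).trans (hrε 0)
  let P : ℝ → ℝ := fun t => max a (min b t)
  have hP : Continuous P := by fun_prop
  have haP (t : ℝ) : a ≤ P t := le_max_left _ _
  have hPb (t : ℝ) : P t ≤ b := max_le hab (min_le_left _ _)
  let u : ℕ → ℝ → ℝ := fun n =>
    Nat.rec r (fun _ v t => ∫ s in a..P t, K t s * v s) n
  have hu_succ (n : ℕ) (t : ℝ) : u (n + 1) t = ∫ s in a..P t, K t s * u n s := rfl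
  have hu_cont (n : ℕ) : Continuous (u n) := by
    induction n with
    | zero => exact hr
    | succ n ih =>
      exact intervalIntegral.continuous_parametric_intervalIntegral_of_continuous
        (f := fun t s => K t s * u n s) (hK.mul (ih.comp continuous_snd)) hP
  have hu_le (n : ℕ) : ∀ t, |u n t| ≤ ε * ((M * (P t - a)) ^ n / n.factorial) := by
    induction n with
    | zero => simpa [u] using hrε
    | succ n ih =>
      intro t
      have hint : ∫ s in a..P t, M * (ε * ((M * (s - a)) ^ n / n.factorial)) =
          ε * ((M * (P t - a)) ^ (n + 1) / (n + 1).factorial) := by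
        rw [intervalIntegral.integral_comp_sub_right
          (fun s => M * (ε * ((M * s) ^ n / n.factorial)))]
        simp only [mul_pow, intervalIntegral.integral_const_mul,
          intervalIntegral.integral_div, integral_pow, Nat.factorial_succ]
        have : (n.factorial : ℝ) ≠ 0 := by positivity
        push_cast
        field_simp
        simp only [sub_self]
        ring
      rw [← hint, hu_succ, ← Real.norm_eq_abs]
      refine intervalIntegral.norm_integral_le_of_norm_le (haP t)
        (.of_forall fun s hs => ?_) (Continuous.intervalIntegrable (by fun_prop) _ _)
      rw [Real.norm_eq_abs, abs_mul]
      have hPs : P s ≤ s := max_le hs.1.le (min_le_right _ _)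
      have hPa : 0 ≤ P s - a := sub_nonneg.2 (haP s)
      refine mul_le_mul (hKM t s) ((ih s).trans ?_) (abs_nonneg _) hM
      gcongr
  have hu_le' (n : ℕ) (t : ℝ) : |u n t| ≤ ε * ((M * (b - a)) ^ n / n.factorial) := by
    refine (hu_le n t).trans ?_
    have hPa : 0 ≤ P t - a := sub_nonneg.2 (haP t)
    have := hPb t
    gcongr
  have hexp : HasSum (fun n : ℕ => ε * ((M * (b - a)) ^ n / n.factorial))
      (ε * Real.exp (M * (b - a))) := by
    rw [Real.exp_eq_exp_ℝ]
    exact (NormedSpace.expSeries_div_hasSum_exp (M * (b - a))).mul_left ε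
  have hu_sum (t : ℝ) : Summable fun n => u n t :=
    .of_norm_bounded hexp.summable (hu_le' · t)
  refine ⟨fun t => ∑' n, u n t, continuous_tsum hu_cont hexp.summable hu_le', fun t ht => ?_,
    fun t => tsum_of_norm_bounded (f := fun n => u n t) hexp (hu_le' · t)⟩
  have hPt : P t = t := by simp [P, ht.1, ht.2]
  have hT : HasSum (fun n => ∫ s in a..t, K t s * u n s)
      (∫ s in a..t, K t s * ∑' n, u n s) := by
    refine intervalIntegral.hasSum_integral_of_dominated_convergence
      (fun n _ => M * (ε * ((M * (b - a)) ^ n / n.factorial)))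
      (fun n => Continuous.aestronglyMeasurable ?_) (fun n => .of_forall fun s _ => ?_)
      (.of_forall fun _ _ => hexp.summable.mul_left M) (by simp)
      (.of_forall fun s _ => (hu_sum s).hasSum.mul_left _)
    · exact (hK.comp (by fun_prop : Continuous fun s => (t, s))).mul (hu_cont n)
    · rw [Real.norm_eq_abs, abs_mul]
      exact mul_le_mul (hKM t s) (hu_le' n s) (abs_nonneg _) hM
  beta_reduce
  rw [(hu_sum t).tsum_eq_zero_add, ← hT.tsum_eq]
  simp only [hu_succ, hPt]
  rfl

/-- Hyers–Ulam stability of the Volterra integral equation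
`x t = f t + ∫ s in a..t, k (t, s) * x s` on `[a, b] ⊆ ℝ`,
with stability constant `1 + exp (M * (b - a))`. -/
theorem volterra_hyers_ulam_stability
    (a b M : ℝ) (hab : a < b)
    (f : ℝ → ℝ) (hf : ContinuousOn f (Set.Icc a b))
    (k : ℝ × ℝ → ℝ)
    (hk : ContinuousOn k (Set.Icc a b ×ˢ Set.Icc a b))
    (hkM : ∀ t ∈ Set.Icc a b, ∀ s ∈ Set.Icc a b, |k (t, s)| ≤ M)
    (ε : ℝ) (hε : 0 < ε)
    (ψ : ℝ → ℝ) (hψc : Continuous ψ)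
    (hψ : ∀ t ∈ Set.Icc a b, |ψ t - f t - ∫ s in a..t, k (t, s) * ψ s| ≤ ε) :
    ∃ φ : ℝ → ℝ, Continuous φ ∧
      (∀ t ∈ Set.Icc a b, φ t = f t + ∫ s in a..t, k (t, s) * φ s) ∧
      (∀ t ∈ Set.Icc a b, |φ t - ψ t| ≤ (1 + Real.exp (M * (b - a))) * ε) := by
  let P : ℝ → ℝ := fun t => max a (min b t)
  have hP : Continuous P := by fun_prop
  have hPm (t : ℝ) : P t ∈ Set.Icc a b :=
    ⟨le_max_left _ _, max_le hab.le (min_le_left _ _)⟩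
  have hPt {t : ℝ} (ht : t ∈ Set.Icc a b) : P t = t := by simp [P, ht.1, ht.2]
  let K : ℝ → ℝ → ℝ := fun t s => k (P t, P s)
  have hK : Continuous (Function.uncurry K) :=
    hk.comp_continuous (f := fun p : ℝ × ℝ => (P p.1, P p.2)) (by fun_prop)
      fun p => ⟨hPm p.1, hPm p.2⟩
  have hKk {t : ℝ} (ht : t ∈ Set.Icc a b) (g : ℝ → ℝ) :
      ∫ s in a..t, K t s * g s = ∫ s in a..t, k (t, s) * g s := by
    refine intervalIntegral.integral_congr fun s hs => ?_
    rw [Set.uIcc_of_le ht.1] at hs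
    simp only [K, hPt ht, hPt ⟨hs.1, hs.2.trans ht.2⟩]
  have hKint (t : ℝ) {g : ℝ → ℝ} (hg : Continuous g) :
      IntervalIntegrable (fun s => K t s * g s) MeasureTheory.volume a t :=
    ((hK.comp (by fun_prop : Continuous fun s => (t, s))).mul hg).intervalIntegrable _ _
  let r : ℝ → ℝ := fun t => f (P t) + (∫ s in a..P t, K (P t) s * ψ s) - ψ (P t)
  have hr : Continuous r := by
    refine ((hf.comp_continuous hP hPm).add ?_).sub (hψc.comp hP)
    refine intervalIntegral.continuous_parametric_intervalIntegral_of_continuous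
      (f := fun t s => K (P t) s * ψ s) ?_ hP
    exact (hK.comp (by fun_prop : Continuous fun p : ℝ × ℝ => (P p.1, p.2))).mul
      (hψc.comp continuous_snd)
  have hrε (t : ℝ) : |r t| ≤ ε := by
    have h := hψ (P t) (hPm t)
    rw [← hKk (hPm t), ← abs_neg] at h
    convert h using 2
    simp only [r]
    ring
  obtain ⟨δ, hδc, hδ, hδε⟩ := exists_volterra_solution_abs_le hab.le hK
    (fun t s => hkM _ (hPm t) _ (hPm s)) hr hrε
  refine ⟨fun t => ψ t + δ t, hψc.add hδc, fun t ht => ?_, fun t _ => ?_⟩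
  · rw [← hKk ht]
    beta_reduce
    rw [hδ t ht]
    simp only [mul_add]
    rw [intervalIntegral.integral_add (hKint t hψc) (hKint t hδc)]
    simp only [r, hPt ht]
    ring
  · rw [add_sub_cancel_left]
    linarith [hδε t]
end

section
/- Let a < b be real numbers, let f : ℝ → ℝ be continuous on [a,b], let k : ℝ × ℝ → ℝ be continuous on [a,b] × [a,b] with |k(t,s)| ≤ M for all t,s ∈ [a,b], let ε > 0, and let ψ : ℝ → ℝ be continuous with |ψ(t) - f(t) - ∫_a^t k(t,s) ψ(s) ds| ≤ ε for all t ∈ [a,b]. Define the Picard iterates ψ₀ = ψ and ψ_n(t) = f(t) + ∫_a^t k(t,s) ψ_{n-1}(s) ds for n ≥ 1. Then for every n ≥ 1 and every t ∈ [a,b], |ψ_n(t) - ψ_{n-1}(t)| ≤ ε · M^{n-1} (t-a)^{n-1} / (n-1)!. -/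
/-- The Volterra integral operator with kernel continuous on a square preserves continuity. -/
theorem ContinuousOn.volterra_integral {a b : ℝ} {k : ℝ × ℝ → ℝ} {x : ℝ → ℝ} (hab : a ≤ b)
    (hk : ContinuousOn k (Set.Icc a b ×ˢ Set.Icc a b)) (hx : ContinuousOn x (Set.Icc a b)) :
    ContinuousOn (fun t => ∫ s in a..t, k (t, s) * x s) (Set.Icc a b) := by
  let c : ℝ → ℝ := fun t => Set.projIcc a b hab t
  have hc : Continuous c := continuous_subtype_val.comp continuous_projIcc
  have hc_mem (t : ℝ) : c t ∈ Set.Icc a b := (Set.projIcc a b hab t).2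
  have hc_eq {t : ℝ} (ht : t ∈ Set.Icc a b) : c t = t := by
    simp [c, Set.projIcc_of_mem hab ht]
  have hK : Continuous (fun p : ℝ × ℝ => k (c p.1, c p.2)) :=
    hk.comp_continuous (by fun_prop) fun p => ⟨hc_mem p.1, hc_mem p.2⟩
  have hX : Continuous (fun s => x (c s)) := hx.comp_continuous hc hc_mem
  have hcont : Continuous (fun t => ∫ s in a..t, k (c t, c s) * x (c s)) :=
    intervalIntegral.continuous_parametric_intervalIntegral_of_continuous
      (f := fun t s => k (c t, c s) * x (c s))
      (hK.mul (hX.comp continuous_snd)) continuous_id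
  refine hcont.continuousOn.congr fun t ht => intervalIntegral.integral_congr fun s hs => ?_
  rw [Set.uIcc_of_le ht.1] at hs
  simp only [hc_eq ht, hc_eq (Set.Icc_subset_Icc_right ht.2 hs)]

/-- The key inductive estimate for the Picard iterates in the proof of
Hyers–Ulam stability of the Volterra integral equation on `[a, b] ⊆ ℝ`:
`|ψ_n t - ψ_{n-1} t| ≤ ε * M ^ (n-1) * (t - a) ^ (n-1) / (n-1)!` (stated with
`n` shifted by one, so for all `n ≥ 0`). -/
theorem volterra_picard_iterate_estimate
    (a b M : ℝ) (hab : a < b)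
    (f : ℝ → ℝ) (hf : ContinuousOn f (Set.Icc a b))
    (k : ℝ × ℝ → ℝ)
    (hk : ContinuousOn k (Set.Icc a b ×ˢ Set.Icc a b))
    (hkM : ∀ t ∈ Set.Icc a b, ∀ s ∈ Set.Icc a b, |k (t, s)| ≤ M)
    (ε : ℝ) (hε : 0 < ε)
    (ψ : ℝ → ℝ) (hψc : Continuous ψ)
    (hψ : ∀ t ∈ Set.Icc a b, |ψ t - f t - ∫ s in a..t, k (t, s) * ψ s| ≤ ε)
    (Ψ : ℕ → ℝ → ℝ) (hΨ0 : Ψ 0 = ψ)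
    (hΨ : ∀ n : ℕ, ∀ t : ℝ, Ψ (n + 1) t = f t + ∫ s in a..t, k (t, s) * Ψ n s) :
    ∀ n : ℕ, ∀ t ∈ Set.Icc a b,
      |Ψ (n + 1) t - Ψ n t| ≤ ε * M ^ n * (t - a) ^ n / (n.factorial : ℝ) := by
  have hM : 0 ≤ M :=
    (abs_nonneg _).trans (hkM a (Set.left_mem_Icc.2 hab.le) a (Set.left_mem_Icc.2 hab.le))
  have hcont (n : ℕ) : ContinuousOn (Ψ n) (Set.Icc a b) := by
    induction n with
    | zero => exact hΨ0 ▸ hψc.continuousOn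
    | succ n ih => exact (hf.add (hk.volterra_integral hab.le ih)).congr fun t _ => hΨ n t
  have hint (n : ℕ) {t : ℝ} (ht : t ∈ Set.Icc a b) :
      IntervalIntegrable (fun s => k (t, s) * Ψ n s) MeasureTheory.volume a t := by
    have hsub : Set.Icc a t ⊆ Set.Icc a b := Set.Icc_subset_Icc_right ht.2
    refine ContinuousOn.intervalIntegrable_of_Icc ht.1 (ContinuousOn.mul ?_ ((hcont n).mono hsub))
    exact hk.comp (by fun_prop) fun s hs => ⟨ht, hsub hs⟩
  intro n
  induction n with
  | zero =>
    intro t ht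
    have h := hψ t ht
    rw [hΨ 0 t, hΨ0, abs_sub_comm, ← sub_sub]
    simpa using h
  | succ n ih =>
    intro t ht
    have hdiff : Ψ (n + 1 + 1) t - Ψ (n + 1) t =
        ∫ s in a..t, k (t, s) * (Ψ (n + 1) s - Ψ n s) := by
      rw [hΨ (n + 1) t, hΨ n t, add_sub_add_left_eq_sub,
        ← intervalIntegral.integral_sub (hint (n + 1) ht) (hint n ht)]
      simp only [mul_sub]
    have hle : ‖∫ s in a..t, k (t, s) * (Ψ (n + 1) s - Ψ n s)‖ ≤
        ∫ s in a..t, M * (ε * M ^ n * (s - a) ^ n / (n.factorial : ℝ)) := by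
      refine intervalIntegral.norm_integral_le_of_norm_le ht.1 (.of_forall fun s hs => ?_)
        (Continuous.intervalIntegrable (by fun_prop) _ _)
      have hs' : s ∈ Set.Icc a b := ⟨hs.1.le, hs.2.trans ht.2⟩
      rw [norm_mul]
      exact mul_le_mul (hkM t ht s hs') (ih s hs') (norm_nonneg _) hM
    have hpow : ∫ s in a..t, (s - a) ^ n = (t - a) ^ (n + 1) / (n + 1) := by
      rw [intervalIntegral.integral_comp_sub_right (fun s => s ^ n) a]
      simp
    rw [hdiff]
    refine hle.trans_eq ?_
    rw [intervalIntegral.integral_const_mul, intervalIntegral.integral_div,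
      intervalIntegral.integral_const_mul, hpow, Nat.factorial_succ]
    push_cast
    field_simp
    ring
end

section
/- Let a < b be real numbers, let f : ℝ → ℝ be continuous on [a,b], and let k : ℝ × ℝ → ℝ be continuous on [a,b] × [a,b] with |k(t,s)| ≤ M for all t,s ∈ [a,b]. Suppose ψ₁, ψ₂ : ℝ → ℝ are continuous and there are ε₁, ε₂ > 0 such that |ψ₁(t) - f(t) - ∫_a^t k(t,s) ψ₁(s) ds| ≤ ε₁ and |ψ₂(t) - f(t) - ∫_a^t k(t,s) ψ₂(s) ds| ≤ ε₂ for all t ∈ [a,b]. Then |ψ₁(t) - ψ₂(t)| ≤ (ε₁ + ε₂) e^{M(t-a)} for all t ∈ [a,b]. -/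
/-- **Grönwall's inequality**, integral form with constant coefficients. -/
theorem le_mul_exp_of_le_add_mul_integral {u : ℝ → ℝ} {a b c K : ℝ} (hu : Continuous u)
    (hK : 0 ≤ K) (h : ∀ t ∈ Set.Icc a b, u t ≤ c + K * ∫ s in a..t, u s) :
    ∀ t ∈ Set.Icc a b, u t ≤ c * Real.exp (K * (t - a)) := by
  have hderiv (t : ℝ) : HasDerivAt (fun t => c + K * ∫ s in a..t, u s) (K * u t) t :=
    ((hu.integral_hasStrictDerivAt a t).hasDerivAt.const_mul K).const_add c
  intro t ht
  refine (h t ht).trans ?_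
  rw [← gronwallBound_ε0]
  refine le_gronwallBound_of_liminf_deriv_right_le (f' := fun t => K * u t) (b := b)
    (fun x _ => (hderiv x).continuousAt.continuousWithinAt)
    (fun x _ r hr => (hderiv x).hasDerivWithinAt.liminf_right_slope_le hr) (by simp) ?_ t ht
  intro x hx
  simpa using mul_le_mul_of_nonneg_left (h x (Set.Ico_subset_Icc_self hx)) hK

theorem ContinuousOn.intervalIntegrable_section_mul {k : ℝ × ℝ → ℝ} {a b t : ℝ}
    (hk : ContinuousOn k (Set.Icc a b ×ˢ Set.Icc a b)) (ht : t ∈ Set.Icc a b)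
    {ψ : ℝ → ℝ} (hψ : Continuous ψ) :
    IntervalIntegrable (fun s => k (t, s) * ψ s) MeasureTheory.volume a t := by
  apply ContinuousOn.intervalIntegrable
  rw [Set.uIcc_of_le ht.1]
  exact (hk.comp (by fun_prop) fun s hs => ⟨ht, hs.1, hs.2.trans ht.2⟩).mul hψ.continuousOn

/-- Two approximate solutions of the Volterra integral equation with defects
`ε₁` and `ε₂` differ by at most `(ε₁ + ε₂) * exp (M * (t - a))` on `[a, b]`. -/
theorem volterra_two_approximate_solutions
    (a b M : ℝ) (hab : a < b)
    (f : ℝ → ℝ) (hf : ContinuousOn f (Set.Icc a b))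
    (k : ℝ × ℝ → ℝ)
    (hk : ContinuousOn k (Set.Icc a b ×ˢ Set.Icc a b))
    (hkM : ∀ t ∈ Set.Icc a b, ∀ s ∈ Set.Icc a b, |k (t, s)| ≤ M)
    (ψ₁ ψ₂ : ℝ → ℝ) (hψ₁c : Continuous ψ₁) (hψ₂c : Continuous ψ₂)
    (ε₁ ε₂ : ℝ) (hε₁ : 0 < ε₁) (hε₂ : 0 < ε₂)
    (hψ₁ : ∀ t ∈ Set.Icc a b, |ψ₁ t - f t - ∫ s in a..t, k (t, s) * ψ₁ s| ≤ ε₁)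
    (hψ₂ : ∀ t ∈ Set.Icc a b, |ψ₂ t - f t - ∫ s in a..t, k (t, s) * ψ₂ s| ≤ ε₂) :
    ∀ t ∈ Set.Icc a b, |ψ₁ t - ψ₂ t| ≤ (ε₁ + ε₂) * Real.exp (M * (t - a)) := by
  have hM : 0 ≤ M := by
    have ha : a ∈ Set.Icc a b := Set.left_mem_Icc.2 hab.le
    exact (abs_nonneg _).trans (hkM a ha a ha)
  refine le_mul_exp_of_le_add_mul_integral (u := fun t => |ψ₁ t - ψ₂ t|) (by fun_prop) hM ?_
  intro t ht
  have hint : |(∫ s in a..t, k (t, s) * ψ₁ s) - ∫ s in a..t, k (t, s) * ψ₂ s| ≤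
      M * ∫ s in a..t, |ψ₁ s - ψ₂ s| := by
    rw [← intervalIntegral.integral_sub (hk.intervalIntegrable_section_mul ht hψ₁c)
      (hk.intervalIntegrable_section_mul ht hψ₂c), ← intervalIntegral.integral_const_mul,
      ← Real.norm_eq_abs]
    refine intervalIntegral.norm_integral_le_of_norm_le (μ := MeasureTheory.volume) ht.1
      (.of_forall fun s hs => ?_)
      (((hψ₁c.sub hψ₂c).abs.const_mul M).intervalIntegrable a t)
    rw [← mul_sub, Real.norm_eq_abs, abs_mul]
    exact mul_le_mul_of_nonneg_right (hkM t ht s ⟨hs.1.le, hs.2.trans ht.2⟩) (abs_nonneg _)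
  have h₁ := abs_le.1 (hψ₁ t ht)
  have h₂ := abs_le.1 (hψ₂ t ht)
  have h₃ := abs_le.1 hint
  exact abs_le.2 ⟨by linarith, by linarith⟩
end

section
/- Let a < b be real numbers, let f : ℝ → ℝ be continuous on [a,b], and let k : ℝ × ℝ → ℝ be continuous on [a,b] × [a,b] with |k(t,s)| ≤ M for all t,s ∈ [a,b]. Let ω : ℝ → ℝ be continuous and nonnegative on [a,b], and suppose there is a constant P ∈ (0,1) with ∫_a^t ω(s) ds ≤ P ω(t) for all t ∈ [a,b], and suppose M·P < 1. Then for every continuous ψ : ℝ → ℝ satisfying |ψ(t) - f(t) - ∫_a^t k(t,s) ψ(s) ds| ≤ ω(t) for all t ∈ [a,b], there exists a continuous function φ : ℝ → ℝ satisfying φ(t) = f(t) + ∫_a^t k(t,s) φ(s) ds for all t ∈ [a,b] and such that |φ(t) - ψ(t)| ≤ (1 + 1/(1 - M·P)) ω(t) for all t ∈ [a,b]. In other words, the Volterra integral equation has Hyers–Ulam–Rassias stability with respect to ω on [a,b]. -/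
open MeasureTheory in
/-- Resolvent estimate for a Volterra equation of the second kind: if the free term is dominated by
a weight `ω` with `∫ s in a..t, ω s ≤ P * ω t`, then so is a solution, up to `(1 - M * P)⁻¹`. -/
theorem exists_volterra_solution_of_le_weight {a b M P : ℝ} (hab : a ≤ b) {K : ℝ → ℝ → ℝ}
    (hK : Continuous (Function.uncurry K))
    (hKM : ∀ t ∈ Set.Icc a b, ∀ s ∈ Set.Icc a b, |K t s| ≤ M)
    {ω : ℝ → ℝ} (hωc : ContinuousOn ω (Set.Icc a b)) (hω0 : ∀ t ∈ Set.Icc a b, 0 ≤ ω t)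
    (hP : 0 ≤ P) (hωP : ∀ t ∈ Set.Icc a b, (∫ s in a..t, ω s) ≤ P * ω t) (hMP : M * P < 1)
    {e : ℝ → ℝ} (hec : Continuous e) (he : ∀ t ∈ Set.Icc a b, |e t| ≤ ω t) :
    ∃ u : ℝ → ℝ, ContinuousOn u (Set.Icc a b) ∧
      (∀ t ∈ Set.Icc a b, u t = e t + ∫ s in a..t, K t s * u s) ∧
      ∀ t ∈ Set.Icc a b, |u t| ≤ (1 - M * P)⁻¹ * ω t := by
  have haI : a ∈ Set.Icc a b := Set.left_mem_Icc.2 hab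
  have hM : 0 ≤ M := (abs_nonneg _).trans (hKM a haI a haI)
  have hr : 0 ≤ M * P := mul_nonneg hM hP
  let d : ℕ → ℝ → ℝ := fun n ↦ (fun g t ↦ ∫ s in a..t, K t s * g s)^[n] e
  have hd_succ (n : ℕ) (t : ℝ) : d (n + 1) t = ∫ s in a..t, K t s * d n s := by
    simp only [d, Function.iterate_succ_apply']
  have hdc (n : ℕ) : Continuous (d n) := by
    induction n with
    | zero => exact hec
    | succ n ih =>
      rw [funext (hd_succ n)]
      exact intervalIntegral.continuous_parametric_intervalIntegral_of_continuous
        (f := fun t s ↦ K t s * d n s)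
        (hK.mul (ih.comp continuous_snd)) continuous_id
  have hsub {t : ℝ} (ht : t ∈ Set.Icc a b) {s : ℝ} (hs : s ∈ Set.Icc a t) : s ∈ Set.Icc a b :=
    ⟨hs.1, hs.2.trans ht.2⟩
  have hd (n : ℕ) : ∀ t ∈ Set.Icc a b, |d n t| ≤ (M * P) ^ n * ω t := by
    induction n with
    | zero => simpa [d] using he
    | succ n ih =>
      intro t ht
      have hωi : IntervalIntegrable ω volume a t := by
        refine ContinuousOn.intervalIntegrable_of_Icc ht.1 (hωc.mono fun s hs ↦ hsub ht hs)
      calc |d (n + 1) t| ≤ ∫ s in a..t, M * (M * P) ^ n * ω s := by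
            rw [hd_succ, ← Real.norm_eq_abs]
            refine intervalIntegral.norm_integral_le_of_norm_le ht.1 ?_ (hωi.const_mul _)
            refine Filter.Eventually.of_forall fun s hs ↦ ?_
            have hs' := hsub ht (Set.Ioc_subset_Icc_self hs)
            rw [Real.norm_eq_abs, abs_mul, mul_assoc]
            exact mul_le_mul (hKM t ht s hs') (ih s hs') (abs_nonneg _) hM
        _ = M * (M * P) ^ n * ∫ s in a..t, ω s := intervalIntegral.integral_const_mul _ _
        _ ≤ M * (M * P) ^ n * (P * ω t) := by gcongr; exact hωP t ht
        _ = (M * P) ^ (n + 1) * ω t := by ring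
  have hgeom (t : ℝ) : HasSum (fun n ↦ (M * P) ^ n * ω t) ((1 - M * P)⁻¹ * ω t) :=
    (hasSum_geometric_of_lt_one hr hMP).mul_right _
  have hdsum {t : ℝ} (ht : t ∈ Set.Icc a b) : Summable fun n ↦ d n t :=
    .of_norm_bounded (hgeom t).summable fun n ↦ hd n t ht
  obtain ⟨C, hC⟩ := (isCompact_Icc (a := a) (b := b)).exists_bound_of_continuousOn hωc
  have hωC : ∀ t ∈ Set.Icc a b, ω t ≤ C := fun t ht ↦ (le_abs_self _).trans (hC t ht)
  have hC0 : 0 ≤ C := (hω0 a haI).trans (hωC a haI)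
  have hCsum : Summable fun n ↦ (M * P) ^ n * C :=
    (summable_geometric_of_lt_one hr hMP).mul_right _
  have hdC (n : ℕ) (t : ℝ) (ht : t ∈ Set.Icc a b) : ‖d n t‖ ≤ (M * P) ^ n * C :=
    (hd n t ht).trans (mul_le_mul_of_nonneg_left (hωC t ht) (pow_nonneg hr n))
  refine ⟨fun t ↦ ∑' n, d n t, continuousOn_tsum (fun n ↦ (hdc n).continuousOn) hCsum hdC,
    fun t ht ↦ ?_, fun t ht ↦ ?_⟩
  swap
  · exact (Real.norm_eq_abs _).symm.trans_le
      (tsum_of_norm_bounded (hgeom t) fun n ↦ hd n t ht)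
  have hint : HasSum (fun n ↦ d (n + 1) t) (∫ s in a..t, K t s * ∑' n, d n s) := by
    simp only [hd_succ]
    have hmem {s : ℝ} (hs : s ∈ Set.uIoc a t) : s ∈ Set.Icc a b :=
      hsub ht (Set.Ioc_subset_Icc_self (Set.uIoc_of_le ht.1 ▸ hs))
    refine intervalIntegral.hasSum_integral_of_dominated_convergence
      (fun n _ ↦ M * ((M * P) ^ n * C)) (fun n ↦ ?_) (fun n ↦ ?_) ?_ ?_ ?_
    · exact ((hK.comp (Continuous.prodMk_right t)).mul (hdc n)).aestronglyMeasurable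
    · refine Filter.Eventually.of_forall fun s hs ↦ ?_
      rw [norm_mul]
      exact mul_le_mul (hKM t ht s (hmem hs)) (hdC n s (hmem hs)) (norm_nonneg _) hM
    · exact Filter.Eventually.of_forall fun s _ ↦ hCsum.mul_left M
    · exact intervalIntegrable_const
    · exact Filter.Eventually.of_forall fun s hs ↦ (hdsum (hmem hs)).hasSum.mul_left _
  rw [← hint.tsum_eq]
  exact (hdsum ht).tsum_eq_zero_add

/-- Hyers–Ulam–Rassias stability of the Volterra integral equation on `[a, b]`
with respect to `ω`, with stability constant `1 + 1 / (1 - M * P)`. -/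
theorem volterra_hyers_ulam_rassias_stability
    (a b M : ℝ) (hab : a < b)
    (f : ℝ → ℝ) (hf : ContinuousOn f (Set.Icc a b))
    (k : ℝ × ℝ → ℝ)
    (hk : ContinuousOn k (Set.Icc a b ×ˢ Set.Icc a b))
    (hkM : ∀ t ∈ Set.Icc a b, ∀ s ∈ Set.Icc a b, |k (t, s)| ≤ M)
    (ω : ℝ → ℝ) (hωc : ContinuousOn ω (Set.Icc a b))
    (hω0 : ∀ t ∈ Set.Icc a b, 0 ≤ ω t)
    (P : ℝ) (hP : P ∈ Set.Ioo (0 : ℝ) 1)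
    (hωP : ∀ t ∈ Set.Icc a b, (∫ s in a..t, ω s) ≤ P * ω t)
    (hMP : M * P < 1)
    (ψ : ℝ → ℝ) (hψc : Continuous ψ)
    (hψ : ∀ t ∈ Set.Icc a b, |ψ t - f t - ∫ s in a..t, k (t, s) * ψ s| ≤ ω t) :
    ∃ φ : ℝ → ℝ, Continuous φ ∧
      (∀ t ∈ Set.Icc a b, φ t = f t + ∫ s in a..t, k (t, s) * φ s) ∧
      (∀ t ∈ Set.Icc a b, |φ t - ψ t| ≤ (1 + 1 / (1 - M * P)) * ω t) := by
  let c : ℝ → ℝ := fun t ↦ Set.projIcc a b hab.le t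
  have hcc : Continuous c := continuous_subtype_val.comp continuous_projIcc
  have hcm (t : ℝ) : c t ∈ Set.Icc a b := (Set.projIcc a b hab.le t).2
  have hc {t : ℝ} (ht : t ∈ Set.Icc a b) : c t = t := by simp [c, Set.projIcc_of_mem hab.le ht]
  let K : ℝ → ℝ → ℝ := fun t s ↦ k (c t, c s)
  have hK : Continuous (Function.uncurry K) :=
    hk.comp_continuous (f := fun p : ℝ × ℝ ↦ (c p.1, c p.2)) (by fun_prop)
      fun p ↦ ⟨hcm p.1, hcm p.2⟩
  have hKk (g : ℝ → ℝ) {t : ℝ} (ht : t ∈ Set.Icc a b) :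
      ∫ s in a..t, K t s * g s = ∫ s in a..t, k (t, s) * g s := by
    refine intervalIntegral.integral_congr fun s hs ↦ ?_
    rw [Set.uIcc_of_le ht.1] at hs
    simp only [K, hc ht, hc (⟨hs.1, hs.2.trans ht.2⟩ : s ∈ Set.Icc a b)]
  have hFc : Continuous fun t ↦ f (c t) := hf.comp_continuous hcc hcm
  have hec : Continuous fun t ↦ f (c t) + (∫ s in a..t, K t s * ψ s) - ψ t :=
    (hFc.add (intervalIntegral.continuous_parametric_intervalIntegral_of_continuous
      (f := fun t s ↦ K t s * ψ s) (hK.mul (hψc.comp continuous_snd)) continuous_id)).sub hψc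
  obtain ⟨u, huc, hu, hub⟩ := exists_volterra_solution_of_le_weight hab.le hK
    (fun t _ s _ ↦ hkM _ (hcm t) _ (hcm s)) hωc hω0 hP.1.le hωP hMP hec fun t ht ↦ by
      rw [hKk ψ ht, hc ht, ← abs_neg]
      convert hψ t ht using 2
      ring
  have huc' : Continuous fun t ↦ u (c t) := huc.comp_continuous hcc hcm
  refine ⟨fun t ↦ ψ t + u (c t), hψc.add huc', fun t ht ↦ ?_, fun t ht ↦ ?_⟩
  · have hKt : Continuous (K t) := hK.comp (Continuous.prodMk_right t)
    have huu : ∫ s in a..t, K t s * u s = ∫ s in a..t, K t s * u (c s) := by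
      refine intervalIntegral.integral_congr fun s hs ↦ ?_
      rw [Set.uIcc_of_le ht.1] at hs
      simp only [hc (⟨hs.1, hs.2.trans ht.2⟩ : s ∈ Set.Icc a b)]
    rw [← hKk _ ht]
    simp only [mul_add]
    have hadd : ∫ s in a..t, (K t s * ψ s + K t s * u (c s)) =
        (∫ s in a..t, K t s * ψ s) + ∫ s in a..t, K t s * u (c s) :=
      intervalIntegral.integral_add ((hKt.mul hψc).intervalIntegrable _ _)
        ((hKt.mul huc').intervalIntegrable _ _)
    rw [hadd, ← huu, hc ht, hu t ht, hc ht]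
    ring
  · rw [add_sub_cancel_left, hc ht, one_div, add_mul, one_mul]
    linarith [hub t ht, hω0 t ht]
end

section
/- Let a < b be real numbers, let f : ℝ → ℝ be continuous on [a,b], let k : ℝ × ℝ → ℝ be continuous on [a,b] × [a,b] with |k(t,s)| ≤ M for all t,s ∈ [a,b], let ω : ℝ → ℝ be continuous and nonnegative on [a,b] with ∫_a^t ω(s) ds ≤ P ω(t) for all t ∈ [a,b], where P ∈ (0,1), and let ψ : ℝ → ℝ be continuous with |ψ(t) - f(t) - ∫_a^t k(t,s) ψ(s) ds| ≤ ω(t) for all t ∈ [a,b]. Define ψ₀ = ψ and ψ_n(t) = f(t) + ∫_a^t k(t,s) ψ_{n-1}(s) ds for n ≥ 1. Then for every n ≥ 1 and every t ∈ [a,b], |ψ_n(t) - ψ_{n-1}(t)| ≤ (M·P)^{n-1} ω(t). -/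
/-- A function of two variables that is continuous on the square `[a, b] × [a, b]` has a continuous
integral over `[a, t]`, as a function of `t ∈ [a, b]`, with `t` also entering as a parameter. -/
theorem continuousOn_intervalIntegral_of_continuousOn_prod {E : Type*} [NormedAddCommGroup E]
    [NormedSpace ℝ E] {a b : ℝ} (hab : a ≤ b) {F : ℝ × ℝ → E}
    (hF : ContinuousOn F (Set.Icc a b ×ˢ Set.Icc a b)) :
    ContinuousOn (fun t => ∫ s in a..t, F (t, s)) (Set.Icc a b) := by
  let π : ℝ → ℝ := fun t => Set.projIcc a b hab t
  have hπ : Continuous π := continuous_subtype_val.comp continuous_projIcc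
  have hG : Continuous (fun p : ℝ × ℝ => F (π p.1, π p.2)) :=
    hF.comp_continuous ((hπ.comp continuous_fst).prodMk (hπ.comp continuous_snd))
      fun p => ⟨(Set.projIcc a b hab p.1).2, (Set.projIcc a b hab p.2).2⟩
  have hcont : Continuous (fun t => ∫ s in a..t, F (π t, π s)) :=
    intervalIntegral.continuous_parametric_intervalIntegral_of_continuous hG continuous_id
  refine hcont.continuousOn.congr fun t ht => intervalIntegral.integral_congr fun s hs => ?_
  rw [Set.uIcc_of_le ht.1] at hs
  have hπ_of_mem : ∀ x ∈ Set.Icc a b, π x = x := fun x hx =>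
    congrArg Subtype.val (Set.projIcc_of_mem hab hx)
  simp only [hπ_of_mem t ht, hπ_of_mem s ⟨hs.1, hs.2.trans ht.2⟩]

/-- A Volterra operator with kernel bounded by `M` turns the bound `C * ω` into `M * C * P * ω`
when `∫ ω ≤ P * ω`. -/
theorem abs_intervalIntegral_mul_le_of_weighted_bound {a t M C P : ℝ} (hat : a ≤ t)
    (hM : 0 ≤ M) (hC : 0 ≤ C) {κ g ω : ℝ → ℝ} (hκ : ∀ s ∈ Set.Icc a t, |κ s| ≤ M)
    (hg : ∀ s ∈ Set.Icc a t, |g s| ≤ C * ω s) (hω : ContinuousOn ω (Set.Icc a t))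
    (hωP : (∫ s in a..t, ω s) ≤ P * ω t) :
    |∫ s in a..t, κ s * g s| ≤ M * C * P * ω t := by
  have hint : IntervalIntegrable (fun s => M * C * ω s) MeasureTheory.volume a t :=
    (hω.intervalIntegrable_of_Icc hat).const_mul _
  calc |∫ s in a..t, κ s * g s| ≤ ∫ s in a..t, M * C * ω s := by
        rw [← Real.norm_eq_abs]
        refine intervalIntegral.norm_integral_le_of_norm_le hat (.of_forall fun s hs => ?_) hint
        have hs' := Set.Ioc_subset_Icc_self hs
        rw [Real.norm_eq_abs, abs_mul, mul_assoc]
        exact mul_le_mul (hκ s hs') (hg s hs') (abs_nonneg _) hM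
    _ = M * C * ∫ s in a..t, ω s := intervalIntegral.integral_const_mul _ _
    _ ≤ M * C * (P * ω t) := by gcongr
    _ = M * C * P * ω t := by ring


/-- The inductive estimate for the Picard iterates in the Hyers–Ulam–Rassias
setting: `|ψ_n t - ψ_{n-1} t| ≤ (M * P) ^ (n-1) * ω t` (stated with `n`
shifted by one, so for all `n ≥ 0`). -/
theorem volterra_rassias_picard_estimate
    (a b M : ℝ) (hab : a < b)
    (f : ℝ → ℝ) (hf : ContinuousOn f (Set.Icc a b))
    (k : ℝ × ℝ → ℝ)
    (hk : ContinuousOn k (Set.Icc a b ×ˢ Set.Icc a b))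
    (hkM : ∀ t ∈ Set.Icc a b, ∀ s ∈ Set.Icc a b, |k (t, s)| ≤ M)
    (ω : ℝ → ℝ) (hωc : ContinuousOn ω (Set.Icc a b))
    (hω0 : ∀ t ∈ Set.Icc a b, 0 ≤ ω t)
    (P : ℝ) (hP : P ∈ Set.Ioo (0 : ℝ) 1)
    (hωP : ∀ t ∈ Set.Icc a b, (∫ s in a..t, ω s) ≤ P * ω t)
    (ψ : ℝ → ℝ) (hψc : Continuous ψ)
    (hψ : ∀ t ∈ Set.Icc a b, |ψ t - f t - ∫ s in a..t, k (t, s) * ψ s| ≤ ω t)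
    (Ψ : ℕ → ℝ → ℝ) (hΨ0 : Ψ 0 = ψ)
    (hΨ : ∀ n : ℕ, ∀ t : ℝ, Ψ (n + 1) t = f t + ∫ s in a..t, k (t, s) * Ψ n s) :
    ∀ n : ℕ, ∀ t ∈ Set.Icc a b, |Ψ (n + 1) t - Ψ n t| ≤ (M * P) ^ n * ω t := by
  have hM : 0 ≤ M :=
    (abs_nonneg _).trans (hkM a (Set.left_mem_Icc.2 hab.le) a (Set.left_mem_Icc.2 hab.le))
  have hkΨ : ∀ n, ContinuousOn (Ψ n) (Set.Icc a b) →
      ContinuousOn (fun p : ℝ × ℝ => k p * Ψ n p.2) (Set.Icc a b ×ˢ Set.Icc a b) :=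
    fun n hn => hk.mul (hn.comp continuousOn_snd fun p hp => hp.2)
  have hΨc : ∀ n, ContinuousOn (Ψ n) (Set.Icc a b) := by
    intro n
    induction n with
    | zero => exact hΨ0 ▸ hψc.continuousOn
    | succ n ih =>
      exact (hf.add (continuousOn_intervalIntegral_of_continuousOn_prod hab.le (hkΨ n ih))).congr
        fun t _ => hΨ n t
  have hint : ∀ n, ∀ t ∈ Set.Icc a b,
      IntervalIntegrable (fun s => k (t, s) * Ψ n s) MeasureTheory.volume a t := by
    intro n t ht
    refine ContinuousOn.intervalIntegrable_of_Icc ht.1 ?_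
    exact (hkΨ n (hΨc n)).comp (f := fun s => (t, s)) (by fun_prop)
      fun s hs => ⟨ht, hs.1, hs.2.trans ht.2⟩
  intro n
  induction n with
  | zero =>
    intro t ht
    rw [hΨ, hΨ0, abs_sub_comm, pow_zero, one_mul, ← sub_sub]
    exact hψ t ht
  | succ n ih =>
    intro t ht
    have hsub : Set.Icc a t ⊆ Set.Icc a b := Set.Icc_subset_Icc_right ht.2
    have hdiff : Ψ (n + 2) t - Ψ (n + 1) t = ∫ s in a..t, k (t, s) * (Ψ (n + 1) s - Ψ n s) := by
      rw [hΨ (n + 1), hΨ n t, add_sub_add_left_eq_sub,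
        ← intervalIntegral.integral_sub (hint _ t ht) (hint _ t ht)]
      simp only [mul_sub]
    rw [hdiff]
    calc |∫ s in a..t, k (t, s) * (Ψ (n + 1) s - Ψ n s)| ≤ M * (M * P) ^ n * P * ω t :=
          abs_intervalIntegral_mul_le_of_weighted_bound ht.1 hM
            (pow_nonneg (mul_nonneg hM hP.1.le) n) (fun s hs => hkM t ht s (hsub hs))
            (fun s hs => ih s (hsub hs)) (hωc.mono hsub) (hωP t ht)
      _ = (M * P) ^ (n + 1) * ω t := by ring
end

section
/- Let a be a real number, let f : ℝ → ℝ be continuous on [a,∞), and let k : ℝ × ℝ → ℝ be continuous on {(t,s) : a ≤ s ≤ t} with |k(t,s)| ≤ M for all a ≤ s ≤ t. Let ω : ℝ → ℝ be continuous and nonnegative on [a,∞), and suppose there is λ ∈ (0,1) with ∫_a^t ω(τ) dτ ≤ λ ω(t) for all t ≥ a, and suppose M·λ < 1. Then for every continuous ψ : ℝ → ℝ satisfying |ψ(t) - f(t) - ∫_a^t k(t,s) ψ(s) ds| ≤ ω(t) for all t ≥ a, there exist a continuous function φ : ℝ → ℝ satisfying φ(t) = f(t) + ∫_a^t k(t,s)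 φ(s) ds for all t ≥ a and a constant C > 0 such that |φ(t) - ψ(t)| ≤ C ω(t) for all t ≥ a. In other words, the Volterra integral equation has Hyers–Ulam–Rassias stability with respect to ω on the unbounded interval [a,∞). -/
open Set Filter Topology MeasureTheory

/-- The iterates `Tⁿ r` of the Volterra operator `(T u)(t) = ∫ s in a..max t a, K t s * u s`. -/
noncomputable def volterraIterate (a : ℝ) (K : ℝ → ℝ → ℝ) (r : ℝ → ℝ) : ℕ → ℝ → ℝ
  | 0 => r
  | n + 1 => fun t => ∫ s in a..max t a, K t s * volterraIterate a K r n s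

lemma continuous_volterra_integral {a : ℝ} {K : ℝ → ℝ → ℝ} (hK : Continuous (Function.uncurry K))
    {u : ℝ → ℝ} (hu : Continuous u) : Continuous fun t => ∫ s in a..max t a, K t s * u s := by
  refine intervalIntegral.continuous_parametric_intervalIntegral_of_continuous
    (f := fun t s => K t s * u s) ?_ (by fun_prop)
  exact hK.mul (hu.comp continuous_snd)

lemma continuous_volterraIterate {a : ℝ} {K : ℝ → ℝ → ℝ} (hK : Continuous (Function.uncurry K))
    {r : ℝ → ℝ} (hr : Continuous r) (n : ℕ) : Continuous (volterraIterate a K r n) := by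
  induction n with
  | zero => exact hr
  | succ n ih => exact continuous_volterra_integral hK ih

lemma abs_volterraIterate_le {a M lam : ℝ} {K : ℝ → ℝ → ℝ} {W r : ℝ → ℝ}
    (hKM : ∀ t s, |K t s| ≤ M) (hW : Continuous W)
    (hWlam : ∀ t, ∫ s in a..max t a, W s ≤ lam * W t) (hM : 0 ≤ M) (hlam : 0 ≤ lam)
    (hrW : ∀ t, |r t| ≤ W t) (n : ℕ) (t : ℝ) :
    |volterraIterate a K r n t| ≤ (M * lam) ^ n * W t := by
  induction n generalizing t with
  | zero => simpa [volterraIterate] using hrW t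
  | succ n ih =>
    have hbound : |∫ s in a..max t a, K t s * volterraIterate a K r n s|
        ≤ ∫ s in a..max t a, M * (M * lam) ^ n * W s := by
      rw [← Real.norm_eq_abs]
      refine intervalIntegral.norm_integral_le_of_norm_le (le_max_right t a)
        (ae_of_all _ fun s _ => ?_) ?_
      · rw [Real.norm_eq_abs, abs_mul, mul_assoc]
        exact mul_le_mul (hKM t s) (ih s) (abs_nonneg _) hM
      · exact Continuous.intervalIntegrable (by fun_prop) _ _
    calc |volterraIterate a K r (n + 1) t|
        ≤ ∫ s in a..max t a, M * (M * lam) ^ n * W s := hbound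
      _ = M * (M * lam) ^ n * ∫ s in a..max t a, W s := intervalIntegral.integral_const_mul _ _
      _ ≤ M * (M * lam) ^ n * (lam * W t) :=
          mul_le_mul_of_nonneg_left (hWlam t) (by positivity)
      _ = (M * lam) ^ (n + 1) * W t := by ring

lemma exists_volterra_solution_of_abs_le {a M lam : ℝ} {K : ℝ → ℝ → ℝ} {W r : ℝ → ℝ}
    (hK : Continuous (Function.uncurry K)) (hKM : ∀ t s, |K t s| ≤ M) (hW : Continuous W)
    (hWlam : ∀ t, ∫ s in a..max t a, W s ≤ lam * W t) (hM : 0 ≤ M) (hlam : 0 ≤ lam)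
    (hMlam : M * lam < 1) (hr : Continuous r) (hrW : ∀ t, |r t| ≤ W t) :
    ∃ u : ℝ → ℝ, Continuous u ∧ (∀ t, u t = r t + ∫ s in a..max t a, K t s * u s) ∧
      ∀ t, |u t| ≤ (1 - M * lam)⁻¹ * W t := by
  have hq : 0 ≤ M * lam := mul_nonneg hM hlam
  have hcont := continuous_volterraIterate (a := a) hK hr
  have hle := abs_volterraIterate_le hKM hW hWlam hM hlam hrW
  have hgeom (c : ℝ) : HasSum (fun n : ℕ => (M * lam) ^ n * c) ((1 - M * lam)⁻¹ * c) :=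
    (hasSum_geometric_of_lt_one hq hMlam).mul_right c
  have hsum (t : ℝ) : Summable fun n => volterraIterate a K r n t :=
    .of_norm_bounded (hgeom (W t)).summable fun n => hle n t
  refine ⟨fun t => ∑' n, volterraIterate a K r n t, ?_, fun t => ?_, fun t => ?_⟩
  · refine continuous_iff_continuousAt.2 fun t₀ => ?_
    have hU : {t | W t < W t₀ + 1} ∈ 𝓝 t₀ :=
      (isOpen_lt hW continuous_const).mem_nhds (lt_add_one (W t₀))
    refine ContinuousOn.continuousAt (continuousOn_tsum (fun n => (hcont n).continuousOn)
      (hgeom (W t₀ + 1)).summable fun n t ht => (hle n t).trans ?_) hU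
    exact mul_le_mul_of_nonneg_left (le_of_lt ht) (pow_nonneg hq n)
  · have hint : HasSum (fun n => ∫ s in a..max t a, K t s * volterraIterate a K r n s)
        (∫ s in a..max t a, K t s * ∑' n, volterraIterate a K r n s) := by
      have hKt : Continuous (K t) := hK.comp (Continuous.prodMk_right t)
      refine intervalIntegral.hasSum_integral_of_dominated_convergence
        (fun n s => (M * lam) ^ n * (M * W s))
        (fun n => (hKt.mul (hcont n)).aestronglyMeasurable)
        (fun n => ae_of_all _ fun s _ => ?_)
        (ae_of_all _ fun s _ => (hgeom (M * W s)).summable) ?_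
        (ae_of_all _ fun s _ => (hsum s).hasSum.mul_left _)
      · rw [Real.norm_eq_abs, abs_mul, mul_left_comm]
        exact mul_le_mul (hKM t s) (hle n s) (abs_nonneg _) hM
      · simp_rw [tsum_mul_right]
        exact Continuous.intervalIntegrable (by fun_prop) _ _
    rw [← hint.tsum_eq]
    exact (hsum t).tsum_eq_zero_add
  · exact tsum_of_norm_bounded (f := fun n => volterraIterate a K r n t) (hgeom (W t))
      fun n => hle n t

/-- Hyers–Ulam–Rassias stability of the Volterra integral equation with
respect to `ω` on the unbounded interval `[a, ∞)`. -/
theorem volterra_hyers_ulam_rassias_unbounded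
    (a M : ℝ)
    (f : ℝ → ℝ) (hf : ContinuousOn f (Set.Ici a))
    (k : ℝ × ℝ → ℝ)
    (hk : ContinuousOn k {p : ℝ × ℝ | a ≤ p.2 ∧ p.2 ≤ p.1})
    (hkM : ∀ t s : ℝ, a ≤ s → s ≤ t → |k (t, s)| ≤ M)
    (ω : ℝ → ℝ) (hωc : ContinuousOn ω (Set.Ici a))
    (hω0 : ∀ t ∈ Set.Ici a, 0 ≤ ω t)
    (lam : ℝ) (hlam : lam ∈ Set.Ioo (0 : ℝ) 1)
    (hωlam : ∀ t ∈ Set.Ici a, (∫ τ in a..t, ω τ) ≤ lam * ω t)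
    (hMlam : M * lam < 1)
    (ψ : ℝ → ℝ) (hψc : Continuous ψ)
    (hψ : ∀ t ∈ Set.Ici a, |ψ t - f t - ∫ s in a..t, k (t, s) * ψ s| ≤ ω t) :
    ∃ φ : ℝ → ℝ, Continuous φ ∧
      (∀ t ∈ Set.Ici a, φ t = f t + ∫ s in a..t, k (t, s) * φ s) ∧
      ∃ C : ℝ, 0 < C ∧ ∀ t ∈ Set.Ici a, |φ t - ψ t| ≤ C * ω t := by
  have hM : 0 ≤ M := (abs_nonneg _).trans (hkM a a le_rfl le_rfl)
  have hmax : Continuous fun t : ℝ => max t a := by fun_prop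
  let K : ℝ → ℝ → ℝ := fun t s => k (max t a, min (max s a) (max t a))
  have hK : Continuous (Function.uncurry K) :=
    hk.comp_continuous (f := fun p : ℝ × ℝ => (max p.1 a, min (max p.2 a) (max p.1 a)))
      (by fun_prop) fun p => ⟨le_min (le_max_right _ _) (le_max_right _ _), min_le_right _ _⟩
  have hKM (t s : ℝ) : |K t s| ≤ M :=
    hkM _ _ (le_min (le_max_right _ _) (le_max_right _ _)) (min_le_right _ _)
  have hKk {t : ℝ} (ht : a ≤ t) (u : ℝ → ℝ) :
      ∫ s in a..t, K t s * u s = ∫ s in a..t, k (t, s) * u s := by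
    refine intervalIntegral.integral_congr fun s hs => ?_
    rw [uIcc_of_le ht] at hs
    simp only [K, max_eq_left ht, max_eq_left hs.1, min_eq_left hs.2]
  have hW : Continuous fun t => ω (max t a) :=
    hωc.comp_continuous hmax fun t => le_max_right t a
  have hWlam (t : ℝ) : ∫ s in a..max t a, ω (max s a) ≤ lam * ω (max t a) := by
    refine le_of_eq_of_le (intervalIntegral.integral_congr fun s hs => ?_)
      (hωlam _ (le_max_right t a))
    rw [uIcc_of_le (le_max_right t a)] at hs
    simp only [max_eq_left hs.1]
  let r : ℝ → ℝ := fun t =>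
    f (max t a) + (∫ s in a..max t a, K t s * ψ s) - ψ (max t a)
  have hr : Continuous r :=
    ((hf.comp_continuous hmax fun t => le_max_right t a).add
      (continuous_volterra_integral hK hψc)).sub (hψc.comp hmax)
  have hrW (t : ℝ) : |r t| ≤ ω (max t a) := by
    have hKt : K t = K (max t a) := by simp [K]
    have h := hψ _ (le_max_right t a)
    rw [← hKk (le_max_right t a), ← hKt, ← abs_neg] at h
    convert h using 2
    simp only [r]
    ring
  obtain ⟨u, hu, hueq, hule⟩ :=
    exists_volterra_solution_of_abs_le hK hKM hW hWlam hM hlam.1.le hMlam hr hrW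
  refine ⟨fun t => ψ t + u t, hψc.add hu, fun t ht => ?_, (1 - M * lam)⁻¹,
    inv_pos.2 (sub_pos.2 hMlam), fun t ht => ?_⟩
  · have hKt : Continuous (K t) := hK.comp (Continuous.prodMk_right t)
    rw [← hKk ht]
    beta_reduce
    rw [hueq t]
    simp only [r, max_eq_left (mem_Ici.1 ht), mul_add]
    rw [intervalIntegral.integral_add ((by fun_prop : Continuous fun s => K t s * ψ s).intervalIntegrable _ _)
      ((by fun_prop : Continuous fun s => K t s * u s).intervalIntegrable _ _)]
    ring
  · simpa [max_eq_left (mem_Ici.1 ht)] using hule t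
end

section
/- The Volterra integral equation x(t) = 1 + 5 ∫_0^t x(s) ds does not have Hyers–Ulam stability on [0,∞). Precisely: the zero function ψ ≡ 0 satisfies |ψ(t) - 1 - 5 ∫_0^t ψ(s) ds| ≤ 1 for all t ≥ 0, yet for every constant C ≥ 0 and every continuous function φ : [0,∞) → ℝ satisfying φ(t) = 1 + 5 ∫_0^t φ(s) ds for all t ≥ 0, there exists t ≥ 0 with |φ(t) - ψ(t)| > C. (Indeed the unique solution is φ(t) = e^{5t}, which satisfies e^{5t} ≥ 1 + 5t and hence sup_{t ≥ 0} |e^{5t}| = ∞.) -/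
/-- A continuous solution of the linear Volterra equation `x t = c + a * ∫ s in 0..t, x s`
on `[0, ∞)` is `t ↦ c * exp (a * t)`. -/
theorem eq_mul_exp_of_eq_add_mul_integral {a c : ℝ} {φ : ℝ → ℝ}
    (hφ : ContinuousOn φ (Set.Ici 0))
    (h : ∀ t, 0 ≤ t → φ t = c + a * ∫ s in (0 : ℝ)..t, φ s) {t : ℝ} (ht : 0 ≤ t) :
    φ t = c * Real.exp (a * t) := by
  set ψ : ℝ → ℝ := fun s => φ (max s 0)
  have hψ : Continuous ψ :=
    hφ.comp_continuous (by fun_prop) fun s => le_max_right s 0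
  have hψφ : ∀ s, 0 ≤ s → ψ s = φ s := fun s hs => by simp [ψ, hs]
  set Φ : ℝ → ℝ := fun t => c + a * ∫ s in (0 : ℝ)..t, ψ s
  have hΦφ : ∀ s, 0 ≤ s → Φ s = φ s := fun s hs => by
    rw [h s hs]
    simp only [Φ]
    congr 2
    refine intervalIntegral.integral_congr fun x hx => hψφ x ?_
    rw [Set.uIcc_of_le hs] at hx
    exact hx.1
  have hΦ : ∀ s, HasDerivAt Φ (a * ψ s) s := fun s =>
    ((hψ.integral_hasStrictDerivAt 0 s).hasDerivAt.const_mul a).const_add c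
  have hexp : ∀ s, HasDerivAt (fun s => Real.exp (-(a * s))) (Real.exp (-(a * s)) * -(a * 1)) s :=
    fun s => ((hasDerivAt_id s).const_mul a).neg.exp
  have hconst := constant_of_has_deriv_right_zero (a := 0) (b := t)
    (f := fun s => Φ s * Real.exp (-(a * s)))
    (fun s _ => ((hΦ s).mul (hexp s)).continuousAt.continuousWithinAt)
    (fun s hs => by
      refine (((hΦ s).mul (hexp s)).congr_deriv ?_).hasDerivWithinAt
      rw [hψφ s hs.1, hΦφ s hs.1]
      ring) t ⟨ht, le_rfl⟩
  have hΦ0 : Φ 0 = c := by simp [Φ]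
  simp only [hΦ0, mul_zero, neg_zero, Real.exp_zero, mul_one] at hconst
  rw [← hΦφ t ht, ← hconst, mul_assoc, ← Real.exp_add, neg_add_cancel, Real.exp_zero, mul_one]

/-- The Volterra equation `x t = 1 + 5 * ∫ s in 0..t, x s` does not have
Hyers–Ulam stability on `[0, ∞)`: the zero function is a `1`-approximate
solution, but no solution stays within a bounded distance of it. -/
theorem volterra_example_no_hyers_ulam_stability :
    (∀ t : ℝ, 0 ≤ t →
      |(0 : ℝ) - 1 - 5 * ∫ s in (0 : ℝ)..t, (0 : ℝ)| ≤ 1) ∧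
    (∀ C : ℝ, 0 ≤ C → ∀ φ : ℝ → ℝ, ContinuousOn φ (Set.Ici (0 : ℝ)) →
      (∀ t : ℝ, 0 ≤ t → φ t = 1 + 5 * ∫ s in (0 : ℝ)..t, φ s) →
      ∃ t : ℝ, 0 ≤ t ∧ C < |φ t - 0|) := by
  refine ⟨fun t _ => by simp, fun C hC φ hφ h => ⟨C, hC, ?_⟩⟩
  rw [eq_mul_exp_of_eq_add_mul_integral hφ h hC, sub_zero, one_mul, Real.abs_exp]
  linarith [Real.add_one_le_exp (5 * C)]
end

section
/- Let a ≤ b be integers, let f : ℤ → ℝ and k : ℤ × ℤ → ℝ with |k(n,s)| ≤ M for all n,s ∈ [a,b] ∩ ℤ. Then for every ε > 0 and every ψ : ℤ → ℝ satisfying |ψ(n) - f(n) - Σ_{s=a}^{n-1} k(n,s) ψ(s)| ≤ ε for all n ∈ [a,b] ∩ ℤ, there exists φ : ℤ → ℝ satisfying φ(n) = f(n) + Σ_{s=a}^{n-1} k(n,s) φ(s) for all n ∈ [a,b] ∩ ℤ and such that |φ(n) - ψ(n)| ≤ ε (1+M)^{n-a} for all n ∈ [a,b] ∩ ℤ; in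 particular |φ(n) - ψ(n)| ≤ (1+M)^{b-a} ε on [a,b] ∩ ℤ, so the discrete Volterra equation has Hyers–Ulam stability on [a,b] ∩ ℤ. -/
/-- The solution of `x n = f n + ∑ s ∈ [a, n), k (n, s) * x s`, by recursion on `n - a`. -/
noncomputable def volterraSolution (a : ℤ) (f : ℤ → ℝ) (k : ℤ × ℤ → ℝ) (n : ℤ) : ℝ :=
  f n + ∑ s : Finset.Ico a n, k (n, s.1) * volterraSolution a f k s.1
termination_by (n - a).toNat
decreasing_by
  have := Finset.mem_Ico.mp s.2
  omega

theorem volterraSolution_eq (a : ℤ) (f : ℤ → ℝ) (k : ℤ × ℤ → ℝ) (n : ℤ) :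
    volterraSolution a f k n =
      f n + ∑ s ∈ Finset.Ico a n, k (n, s) * volterraSolution a f k s := by
  rw [volterraSolution,
    Finset.sum_coe_sort (Finset.Ico a n) fun s => k (n, s) * volterraSolution a f k s]

theorem one_add_mul_sum_Ico_one_add_pow {R : Type*} [CommSemiring R] {a n : ℤ} (han : a ≤ n)
    (M : R) :
    1 + M * ∑ s ∈ Finset.Ico a n, (1 + M) ^ (s - a).toNat = (1 + M) ^ (n - a).toNat := by
  induction n, han using Int.leInduction with
  | base => simp
  | succ n han ih =>
    have hpow : (n + 1 - a).toNat = (n - a).toNat + 1 := by omega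
    rw [← Finset.sum_Ico_add_eq_sum_Ico_add_one han, hpow, pow_succ,
      mul_add, ← add_assoc, ih]
    ring

/-- Discrete Grönwall inequality on an integer interval. -/
theorem le_mul_one_add_pow_of_le_add_mul_sum_Ico {a b : ℤ} {M ε : ℝ} (hM : 0 ≤ M) {u : ℤ → ℝ}
    (hu : ∀ n ∈ Set.Icc a b, u n ≤ ε + M * ∑ s ∈ Finset.Ico a n, u s) :
    ∀ n ∈ Set.Icc a b, u n ≤ ε * (1 + M) ^ (n - a).toNat := by
  intro n hn
  induction h : (n - a).toNat using Nat.strong_induction_on generalizing n with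
  | _ N ih =>
    subst h
    have hsum : ∑ s ∈ Finset.Ico a n, u s ≤
        ∑ s ∈ Finset.Ico a n, ε * (1 + M) ^ (s - a).toNat := by
      refine Finset.sum_le_sum fun s hs => ?_
      obtain ⟨has, hsn⟩ := Finset.mem_Ico.mp hs
      exact ih _ (by omega) s ⟨has, hsn.le.trans hn.2⟩ rfl
    calc u n ≤ ε + M * ∑ s ∈ Finset.Ico a n, u s := hu n hn
      _ ≤ ε + M * ∑ s ∈ Finset.Ico a n, ε * (1 + M) ^ (s - a).toNat := by gcongr
      _ = ε * (1 + M) ^ (n - a).toNat := by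
        rw [← one_add_mul_sum_Ico_one_add_pow hn.1, ← Finset.mul_sum]
        ring


/-- Hyers–Ulam stability of the discrete Volterra equation
`x n = f n + ∑ s in [a, n), k (n, s) * x s` on `[a, b] ∩ ℤ`, with the pointwise
bound `ε * (1 + M) ^ (n - a)` and the uniform constant `(1 + M) ^ (b - a)`. -/
theorem discrete_volterra_hyers_ulam_stability
    (a b : ℤ) (hab : a ≤ b) (M : ℝ)
    (f : ℤ → ℝ) (k : ℤ × ℤ → ℝ)
    (hkM : ∀ n ∈ Set.Icc a b, ∀ s ∈ Set.Icc a b, |k (n, s)| ≤ M)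
    (ε : ℝ) (hε : 0 < ε)
    (ψ : ℤ → ℝ)
    (hψ : ∀ n ∈ Set.Icc a b,
      |ψ n - f n - ∑ s ∈ Finset.Ico a n, k (n, s) * ψ s| ≤ ε) :
    ∃ φ : ℤ → ℝ,
      (∀ n ∈ Set.Icc a b, φ n = f n + ∑ s ∈ Finset.Ico a n, k (n, s) * φ s) ∧
      (∀ n ∈ Set.Icc a b, |φ n - ψ n| ≤ ε * (1 + M) ^ (n - a).toNat) ∧
      (∀ n ∈ Set.Icc a b, |φ n - ψ n| ≤ (1 + M) ^ (b - a).toNat * ε) := by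
  have hM : 0 ≤ M := (abs_nonneg _).trans (hkM a ⟨le_rfl, hab⟩ a ⟨le_rfl, hab⟩)
  have hbound : ∀ n ∈ Set.Icc a b,
      |volterraSolution a f k n - ψ n| ≤ ε * (1 + M) ^ (n - a).toNat := by
    refine le_mul_one_add_pow_of_le_add_mul_sum_Ico hM fun n hn => ?_
    have hsplit : volterraSolution a f k n - ψ n =
        -(ψ n - f n - ∑ s ∈ Finset.Ico a n, k (n, s) * ψ s) +
          ∑ s ∈ Finset.Ico a n, k (n, s) * (volterraSolution a f k s - ψ s) := by
      rw [volterraSolution_eq]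
      simp only [mul_sub, Finset.sum_sub_distrib]
      ring
    rw [hsplit]
    refine (abs_add_le _ _).trans (add_le_add ((abs_neg _).trans_le (hψ n hn)) ?_)
    rw [Finset.mul_sum]
    refine (Finset.abs_sum_le_sum_abs _ _).trans (Finset.sum_le_sum fun s hs => ?_)
    obtain ⟨has, hsn⟩ := Finset.mem_Ico.mp hs
    rw [abs_mul]
    gcongr
    exact hkM n hn s ⟨has, hsn.le.trans hn.2⟩
  refine ⟨volterraSolution a f k, fun n _ => volterraSolution_eq a f k n, hbound,
    fun n hn => (hbound n hn).trans ?_⟩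
  rw [mul_comm]
  gcongr
  · linarith
  · have := hn.2
    omega
end

section
/- Let a ≤ b be integers, let f : ℤ → ℝ and k : ℤ × ℤ → ℝ with |k(n,s)| ≤ M for all n,s ∈ [a,b] ∩ ℤ. Suppose ψ₁, ψ₂ : ℤ → ℝ and ε₁, ε₂ > 0 satisfy |ψᵢ(n) - f(n) - Σ_{s=a}^{n-1} k(n,s) ψᵢ(s)| ≤ εᵢ for all n ∈ [a,b] ∩ ℤ, i = 1,2. Then |ψ₁(n) - ψ₂(n)| ≤ (ε₁ + ε₂)(1+M)^{n-a} for all n ∈ [a,b] ∩ ℤ. -/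
theorem Int.sum_Ico_add_one_top {G : Type*} [AddCommMonoid G] {a n : ℤ} (h : a ≤ n) (u : ℤ → G) :
    ∑ s ∈ Finset.Ico a (n + 1), u s = ∑ s ∈ Finset.Ico a n, u s + u n := by
  rw [← Finset.insert_Ico_right_eq_Ico_add_one h, Finset.sum_insert Finset.right_notMem_Ico,
    add_comm]

/-- The discrete Grönwall inequality on `[a, b] ∩ ℤ`, with a constant forcing term. -/
theorem Int.sum_Ico_gronwall_const {a b : ℤ} {c M : ℝ} (hM : 0 ≤ M) {u : ℤ → ℝ}
    (hu : ∀ n ∈ Set.Icc a b, u n ≤ c + M * ∑ s ∈ Finset.Ico a n, u s) :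
    ∀ n ∈ Set.Icc a b, u n ≤ c * (1 + M) ^ (n - a).toNat := by
  have key : ∀ n, a ≤ n → n ≤ b →
      c + M * ∑ s ∈ Finset.Ico a n, u s ≤ c * (1 + M) ^ (n - a).toNat := by
    intro n han
    induction n, han using Int.leInduction with
    | base => simp
    | succ n han ih =>
      intro hnb
      have hn : n ≤ b := by lia
      have hexp : (n + 1 - a).toNat = (n - a).toNat + 1 := by lia
      rw [Int.sum_Ico_add_one_top han, hexp, pow_succ]
      calc c + M * (∑ s ∈ Finset.Ico a n, u s + u n)
          ≤ c + M * (∑ s ∈ Finset.Ico a n, u s + (c + M * ∑ s ∈ Finset.Ico a n, u s)) := by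
            gcongr
            exact hu n ⟨han, hn⟩
        _ = (c + M * ∑ s ∈ Finset.Ico a n, u s) * (1 + M) := by ring
        _ ≤ c * (1 + M) ^ (n - a).toNat * (1 + M) := by
            gcongr
            exact ih hn
        _ = c * ((1 + M) ^ (n - a).toNat * (1 + M)) := by ring
  exact fun n hn => (hu n hn).trans (key n hn.1 hn.2)

/-- Two approximate solutions of the discrete Volterra equation with defects
`ε₁` and `ε₂` differ by at most `(ε₁ + ε₂) * (1 + M) ^ (n - a)` on `[a, b] ∩ ℤ`. -/
theorem discrete_volterra_two_approximate_solutions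
    (a b : ℤ) (hab : a ≤ b) (M : ℝ)
    (f : ℤ → ℝ) (k : ℤ × ℤ → ℝ)
    (hkM : ∀ n ∈ Set.Icc a b, ∀ s ∈ Set.Icc a b, |k (n, s)| ≤ M)
    (ψ₁ ψ₂ : ℤ → ℝ) (ε₁ ε₂ : ℝ) (hε₁ : 0 < ε₁) (hε₂ : 0 < ε₂)
    (hψ₁ : ∀ n ∈ Set.Icc a b,
      |ψ₁ n - f n - ∑ s ∈ Finset.Ico a n, k (n, s) * ψ₁ s| ≤ ε₁)
    (hψ₂ : ∀ n ∈ Set.Icc a b,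
      |ψ₂ n - f n - ∑ s ∈ Finset.Ico a n, k (n, s) * ψ₂ s| ≤ ε₂) :
    ∀ n ∈ Set.Icc a b, |ψ₁ n - ψ₂ n| ≤ (ε₁ + ε₂) * (1 + M) ^ (n - a).toNat := by
  have ha : a ∈ Set.Icc a b := Set.left_mem_Icc.2 hab
  have hM : 0 ≤ M := (abs_nonneg _).trans (hkM a ha a ha)
  refine Int.sum_Ico_gronwall_const hM (u := fun n => |ψ₁ n - ψ₂ n|) fun n hn => ?_
  have hsum : |∑ s ∈ Finset.Ico a n, k (n, s) * (ψ₁ s - ψ₂ s)| ≤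
      M * ∑ s ∈ Finset.Ico a n, |ψ₁ s - ψ₂ s| := by
    rw [Finset.mul_sum]
    refine (Finset.abs_sum_le_sum_abs _ _).trans (Finset.sum_le_sum fun s hs => ?_)
    rw [Finset.mem_Ico] at hs
    rw [abs_mul]
    gcongr
    exact hkM n hn s ⟨hs.1, hs.2.le.trans hn.2⟩
  simp only [mul_sub, Finset.sum_sub_distrib] at hsum
  have h₁ := abs_le.1 (hψ₁ n hn)
  have h₂ := abs_le.1 (hψ₂ n hn)
  have h₃ := abs_le.1 hsum
  exact abs_le.2 ⟨by linarith, by linarith⟩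
end

section
/- The unique function x : ℕ → ℝ satisfying x(n) = 1 + 5 Σ_{s=0}^{n-1} x(s) for all n ∈ ℕ is x(n) = 6^n. Moreover 6^n ≥ 1 + 5n for all n ∈ ℕ, so sup_{n ∈ ℕ} |x(n) - 0| = ∞; consequently, the zero function satisfies |0 - 1 - 5 Σ_{s=0}^{n-1} 0| ≤ 1 for all n ∈ ℕ, yet for every C ≥ 0 there exists n ∈ ℕ with |x(n) - 0| > C, so the equation does not have Hyers–Ulam stability on ℕ. -/
/-- The discrete Volterra equation `x n = 1 + 5 * ∑ s in range n, x s` has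
`x n = 6 ^ n` as its unique solution; `6 ^ n ≥ 1 + 5 n` (Bernoulli), the zero
function is a `1`-approximate solution, and yet the solution is unbounded, so
the equation has no Hyers–Ulam stability on `ℕ`. -/
theorem discrete_volterra_example_no_hyers_ulam_stability :
    (∀ n : ℕ, (6 : ℝ) ^ n = 1 + 5 * ∑ s ∈ Finset.range n, (6 : ℝ) ^ s) ∧
    (∀ x : ℕ → ℝ, (∀ n : ℕ, x n = 1 + 5 * ∑ s ∈ Finset.range n, x s) →
      ∀ n : ℕ, x n = 6 ^ n) ∧
    (∀ n : ℕ, 1 + 5 * (n : ℝ) ≤ (6 : ℝ) ^ n) ∧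
    (∀ n : ℕ, |(0 : ℝ) - 1 - 5 * ∑ s ∈ Finset.range n, (0 : ℝ)| ≤ 1) ∧
    (∀ C : ℝ, 0 ≤ C → ∃ n : ℕ, C < |(6 : ℝ) ^ n - 0|) := by
  have hsol (n : ℕ) : (6 : ℝ) ^ n = 1 + 5 * ∑ s ∈ Finset.range n, (6 : ℝ) ^ s := by
    linarith [mul_geom_sum (6 : ℝ) n]
  refine ⟨hsol, fun x hx n ↦ ?_, fun n ↦ ?_, fun n ↦ by simp, fun C _ ↦ ?_⟩
  · induction n using Nat.strong_induction_on with
    | _ n ih =>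
      rw [hx n, hsol n, Finset.sum_congr rfl fun s hs ↦ ih s (Finset.mem_range.mp hs)]
  · linarith [one_add_mul_sub_le_pow (by norm_num : (-1 : ℝ) ≤ 6) n]
  · obtain ⟨n, hn⟩ := pow_unbounded_of_one_lt C (by norm_num : (1 : ℝ) < 6)
    exact ⟨n, by rwa [sub_zero, abs_of_pos (by positivity)]⟩
end
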